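/- Let H be a finite graph with e(H) ≥ 1 and let η ∈ (η_H, 1). There exists ε_0 > 0 (depending only on η and H) such that for all ε ∈ (0, ε_0), all n ≥ v(H), and all q ∈ [0,1]^{E(K_n)}: if Σ_{e∈E(K_n)} h(q_e) ≤ binom(n,2)·h(η^{1/e(H)}) + ε²·binom(n,2) and E[N_H(q)] < η·N_H(K_n), then the number of edges e ∈ E(K_n) with q_e < η^{1/η} is at most ε·binom(n,2). -/

import Mathlib

open scoped BigOperators

attribute [local instance] Classical.propDecidable

noncomputable section

namespace LowerTails

/-- The edge set of the complete graph `K_n`: unordered pairs of distinct elements of `Fin n`. -/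
abbrev Edge (n : ℕ) := {e : Sym2 (Fin n) // ¬ e.IsDiag}

/-- A graph on `[n]`, identified with its edge-indicator vector in `{0,1}^{E(K_n)}`. -/
abbrev EGraph (n : ℕ) := Edge n → Bool

/-- The probability of the configuration `G` under the product measure where edge `e`
is present independently with probability `q e`. -/
def wt {n : ℕ} (q : Edge n → ℝ) (G : EGraph n) : ℝ :=
  ∏ e : Edge n, if G e then q e else 1 - q e

/-- Probability of the event `S` under `G(n, q)`. -/
def pr {n : ℕ} (q : Edge n → ℝ) (S : Set (EGraph n)) : ℝ :=
  ∑ G : EGraph n, if G ∈ S then wt q G else 0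

/-- Conditional probability of `S` given `L` under `G(n, q)`. -/
def cpr {n : ℕ} (q : Edge n → ℝ) (L S : Set (EGraph n)) : ℝ :=
  pr q (S ∩ L) / pr q L

/-- Conditional expectation of `f` given the event `L` under `G(n, q)`. -/
def cex {n : ℕ} (q : Edge n → ℝ) (L : Set (EGraph n)) (f : EGraph n → ℝ) : ℝ :=
  (∑ G : EGraph n, if G ∈ L then wt q G * f G else 0) / pr q L

/-- The simple graph on `Fin n` associated to an edge-indicator vector. -/
def toSG {n : ℕ} (G : EGraph n) : SimpleGraph (Fin n) :=
  SimpleGraph.fromEdgeSet {e : Sym2 (Fin n) | ∃ h : ¬e.IsDiag, G ⟨e, h⟩ = true}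

/-- The number of copies of `H` in `G`, i.e. the number of subgraphs of `G` isomorphic to `H`. -/
def countCopies {k n : ℕ} (H : SimpleGraph (Fin k)) (G : SimpleGraph (Fin n)) : ℕ :=
  Set.ncard {K : G.Subgraph | Nonempty (H ≃g K.coe)}

/-- `N_H(G)` for an edge-indicator vector `G`, as a real number. -/
def NH {k n : ℕ} (H : SimpleGraph (Fin k)) (G : EGraph n) : ℝ :=
  countCopies H (toSG G)

/-- `E[N_H(q)]`, the expected number of copies of `H` in `G(n, q)`. -/
def expNH {k : ℕ} (H : SimpleGraph (Fin k)) {n : ℕ} (q : Edge n → ℝ) : ℝ :=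
  ∑ G : EGraph n, wt q G * NH H G

/-- `N_H(K_n)`, the number of copies of `H` in the complete graph `K_n`. -/
def NHKn {k : ℕ} (H : SimpleGraph (Fin k)) (n : ℕ) : ℝ :=
  countCopies H (⊤ : SimpleGraph (Fin n))

/-- The lower tail event `L_p(H, η) = {G : N_H(G) ≤ η E[N_H(p)]}`. -/
def lowerTail {k : ℕ} (H : SimpleGraph (Fin k)) (n : ℕ) (p η : ℝ) : Set (EGraph n) :=
  {G | NH H G ≤ η * expNH H (fun _ : Edge n => p)}

/-- `h(x) = x log x - x + 1` (with `h(0) = 1` since `Real.log 0 = 0`). -/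
def hfun (x : ℝ) : ℝ := x * Real.log x - x + 1

/-- The relative entropy `i_p(t)` of `Ber(t)` with respect to `Ber(p)`. -/
def ip (p t : ℝ) : ℝ := t * Real.log (t / p) + (1 - t) * Real.log ((1 - t) / (1 - p))

/-- The number of edges of `H` as a real number. -/
def eH {k : ℕ} (H : SimpleGraph (Fin k)) : ℝ := H.edgeSet.ncard

/-- The defining equation of the threshold `η_H`, for a graph with `e` edges. -/
def etaEq (e η : ℝ) : Prop :=
  hfun (η ^ (1 / η)) =
    hfun (η ^ (1 / e)) + η ^ (1 / e) * Real.log (η ^ (1 / e)) *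
      (Real.log (η ^ (1 / η)) - Real.log (η ^ (1 / e)))

/-- The 2-density `m_2(H)`. -/
def m2 {k : ℕ} (H : SimpleGraph (Fin k)) : ℝ :=
  sSup {x : ℝ | ∃ F : H.Subgraph, 2 ≤ F.edgeSet.ncard ∧
    x = ((F.edgeSet.ncard : ℝ) - 1) / ((F.verts.ncard : ℝ) - 2)}

/-- The variational problem `Φ_p(H, η)`. -/
def PhiP {k : ℕ} (H : SimpleGraph (Fin k)) (n : ℕ) (p η : ℝ) : ℝ :=
  sInf {x : ℝ | ∃ q : Edge n → ℝ, (∀ e, q e ∈ Set.Icc (0:ℝ) 1) ∧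
    expNH H q ≤ η * expNH H (fun _ : Edge n => p) ∧ x = ∑ e : Edge n, ip p (q e)}

/-- The sparse limit variational problem `Φ(H, η)`. -/
def Phi {k : ℕ} (H : SimpleGraph (Fin k)) (n : ℕ) (η : ℝ) : ℝ :=
  sInf {x : ℝ | ∃ q : Edge n → ℝ, (∀ e, q e ∈ Set.Icc (0:ℝ) 1) ∧
    expNH H q ≤ η * NHKn H n ∧ x = ∑ e : Edge n, hfun (q e)}

/-- The cut norm of an `n × n` real matrix. -/
def cutNorm {n : ℕ} (M : Matrix (Fin n) (Fin n) ℝ) : ℝ :=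
  sSup {x : ℝ | ∃ a b : Fin n → ℝ, (∀ i, a i ∈ Set.Icc (0:ℝ) 1) ∧ (∀ i, b i ∈ Set.Icc (0:ℝ) 1) ∧
    x = |∑ i : Fin n, ∑ j : Fin n, a i * M i j * b j| / (n : ℝ) ^ 2}

/-- The symmetric matrix with entries `q_{ij} - c` off the diagonal, `0` on the diagonal. -/
def devMat {n : ℕ} (q : Edge n → ℝ) (c : ℝ) : Matrix (Fin n) (Fin n) ℝ :=
  fun i j => if h : i = j then 0 else q ⟨s(i, j), by simp [Sym2.mk_isDiag_iff, h]⟩ - c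

/-- The edge-indicator vector of `G` as a real vector. -/
def ind {n : ℕ} (G : EGraph n) : Edge n → ℝ := fun e => if G e then 1 else 0

/-- `Y_A = ∏_{e ∈ A} Y_e`. -/
def YA {n : ℕ} (A : Finset (Edge n)) (G : EGraph n) : ℝ :=
  ∏ e ∈ A, (if G e then (1:ℝ) else 0)

/-- The event that a configuration agrees with `G0` on the set `W`. -/
def agreeOn {n : ℕ} (W : Finset (Edge n)) (G0 : EGraph n) : Set (EGraph n) :=
  {G | ∀ w ∈ W, G w = G0 w}

/-- The conditional expectation `E[f | (Y_w)_{w ∈ W}]` under the pmf `μ`, evaluated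
at the outcome `G0` (i.e. given that `Y` agrees with `G0` on `W`). -/
def condExpW {n : ℕ} (μ : EGraph n → ℝ) (W : Finset (Edge n)) (f : EGraph n → ℝ)
    (G0 : EGraph n) : ℝ :=
  (∑ G : EGraph n, if G ∈ agreeOn W G0 then μ G * f G else 0) /
    (∑ G : EGraph n, if G ∈ agreeOn W G0 then μ G else 0)

/-- The pmf of `G(n, p)` conditioned on the lower tail event `L_p(H, η)`. -/
def ltPMF {k : ℕ} (H : SimpleGraph (Fin k)) (n : ℕ) (p η : ℝ) : EGraph n → ℝ :=
  fun G => (if G ∈ lowerTail H n p η then wt (fun _ : Edge n => p) G else 0) /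
    pr (fun _ : Edge n => p) (lowerTail H n p η)

/-- The hyperedges of the hypergraph `H(H)`: edge sets of copies of `H` in `K_n`. -/
def copySets {k : ℕ} (H : SimpleGraph (Fin k)) (n : ℕ) : Finset (Finset (Edge n)) :=
  Finset.univ.filter (fun A => ∃ f : Fin k ↪ Fin n,
    ∀ e : Edge n, e ∈ A ↔ ∃ u v : Fin k, H.Adj u v ∧ (e : Sym2 (Fin n)) = s(f u, f v))

/-- The correlation `D_W(B, b)` as a random variable (a function of the outcome `G0`). -/
def DW {n : ℕ} (μ : EGraph n → ℝ) (W : Finset (Edge n)) (B : Finset (Edge n)) (b : Edge n)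
    (G0 : EGraph n) : ℝ :=
  condExpW μ W (YA B) G0 - condExpW μ W (YA (B.erase b)) G0 * condExpW μ W (YA {b}) G0

/-- The energy `E_H(W)` of a set `W` with respect to the pmf `μ`. -/
def energy {k n : ℕ} (H : SimpleGraph (Fin k)) (μ : EGraph n → ℝ) (p : ℝ)
    (W : Finset (Edge n)) : ℝ :=
  ∑ G0 : EGraph n, μ G0 *
    ∑ A ∈ (copySets H n).filter (fun A => Disjoint A W),
      ∑ B ∈ A.powerset.filter (fun B => 2 ≤ B.card),
        ∑ b ∈ B, (DW μ W B b G0) ^ 2 /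
          ((Nat.choose H.edgeSet.ncard B.card : ℝ) * (B.card : ℝ) * p ^ (2 * B.card))

end LowerTails

namespace LowerTails

/-! ### The function `x ↦ h (exp x)` and its tangent lines -/

/-- The map `x ↦ h (exp x) - 1`. -/
def gfun (x : ℝ) : ℝ := x * Real.exp x - Real.exp x

lemma hfun_exp (x : ℝ) : hfun (Real.exp x) = gfun x + 1 := by
  simp only [hfun, gfun, Real.log_exp]; ring

lemma hasDerivAt_gfun (x : ℝ) : HasDerivAt gfun (x * Real.exp x) x := by
  have h := ((hasDerivAt_id x).mul (Real.hasDerivAt_exp x)).sub (Real.hasDerivAt_exp x)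
  refine (h.congr_deriv ?_)
  simp

lemma hasDerivAt_mul_exp (x : ℝ) :
    HasDerivAt (fun y : ℝ => y * Real.exp y) ((1 + x) * Real.exp x) x := by
  refine ((hasDerivAt_id x).mul (Real.hasDerivAt_exp x)).congr_deriv ?_
  simp; ring

lemma continuous_mul_exp : Continuous fun y : ℝ => y * Real.exp y := by fun_prop

lemma monotoneOn_mul_exp : MonotoneOn (fun y : ℝ => y * Real.exp y) (Set.Ici (-1)) := by
  refine monotoneOn_of_deriv_nonneg (convex_Ici _) continuous_mul_exp.continuousOn
    (fun x _ => (hasDerivAt_mul_exp x).differentiableAt.differentiableWithinAt) fun x hx => ?_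
  rw [(hasDerivAt_mul_exp x).deriv]
  rw [interior_Ici, Set.mem_Ioi] at hx
  have := Real.exp_pos x
  nlinarith

lemma strictAntiOn_mul_exp : StrictAntiOn (fun y : ℝ => y * Real.exp y) (Set.Iic (-1)) := by
  refine strictAntiOn_of_deriv_neg (convex_Iic _) continuous_mul_exp.continuousOn fun x hx => ?_
  rw [(hasDerivAt_mul_exp x).deriv]
  rw [interior_Iic, Set.mem_Iio] at hx
  have := Real.exp_pos x
  nlinarith

/-- The gap at `x` between `gfun` and its tangent line at `a`. -/
def tangentGap (a x : ℝ) : ℝ := gfun x - gfun a - a * Real.exp a * (x - a)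

lemma continuous_gfun : Continuous gfun := by unfold gfun; fun_prop

lemma exists_tangentGap_eq {x a : ℝ} (h : x < a) :
    ∃ c ∈ Set.Ioo x a, tangentGap a x = (a * Real.exp a - c * Real.exp c) * (a - x) := by
  obtain ⟨c, hc, hc'⟩ := exists_hasDerivAt_eq_slope gfun (fun y => y * Real.exp y) h
    continuous_gfun.continuousOn (fun y _ => hasDerivAt_gfun y)
  refine ⟨c, hc, ?_⟩
  have : a - x ≠ 0 := by linarith
  rw [eq_div_iff this] at hc'
  unfold tangentGap
  linarith

lemma tangentGap_neg {x a : ℝ} (h : x < a) (ha : a ≤ -1) : tangentGap a x < 0 := by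
  obtain ⟨c, hc, hc'⟩ := exists_tangentGap_eq h
  have : a * Real.exp a < c * Real.exp c :=
    strictAntiOn_mul_exp (Set.mem_Iic.2 (hc.2.le.trans ha)) (Set.mem_Iic.2 ha) hc.2
  rw [hc']
  exact mul_neg_of_neg_of_pos (by linarith) (by linarith)

lemma hasDerivAt_tangentGap_left (x a : ℝ) :
    HasDerivAt (fun a => tangentGap a x) ((1 + a) * Real.exp a * (a - x)) a := by
  have h := ((hasDerivAt_gfun a).const_sub (gfun x)).sub
    ((hasDerivAt_mul_exp a).mul ((hasDerivAt_id a).const_sub x))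
  refine h.congr_deriv ?_
  simp; ring

lemma tangentGap_le_tangentGap {x a b : ℝ} (hx : x ≤ a) (ha : -1 ≤ a) (hab : a ≤ b) :
    tangentGap a x ≤ tangentGap b x := by
  have hd := hasDerivAt_tangentGap_left x
  have hm : MonotoneOn (fun a => tangentGap a x) (Set.Ici a) := by
    refine monotoneOn_of_deriv_nonneg (convex_Ici _)
      (fun y _ => (hd y).continuousAt.continuousWithinAt)
      (fun y _ => (hd y).differentiableAt.differentiableWithinAt) fun y hy => ?_
    rw [(hd y).deriv]
    rw [interior_Ici, Set.mem_Ioi] at hy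
    have := Real.exp_pos y
    exact mul_nonneg (mul_nonneg (by linarith) this.le) (by linarith)
  exact hm (Set.mem_Ici.2 le_rfl) (Set.mem_Ici.2 hab) hab

lemma tangentGap_nonneg_of_neg_one_le {x a : ℝ} (hx : -1 ≤ x) (ha : -1 ≤ a) :
    0 ≤ tangentGap a x := by
  rcases lt_trichotomy x a with h | h | h
  · obtain ⟨c, hc, hc'⟩ := exists_tangentGap_eq h
    have : c * Real.exp c ≤ a * Real.exp a :=
      monotoneOn_mul_exp (Set.mem_Ici.2 (hx.trans hc.1.le)) (Set.mem_Ici.2 ha) hc.2.le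
    rw [hc']
    exact mul_nonneg (by linarith) (by linarith)
  · simp [tangentGap, h]
  · obtain ⟨c, hc, hc'⟩ := exists_hasDerivAt_eq_slope gfun (fun y => y * Real.exp y) h
      continuous_gfun.continuousOn (fun y _ => hasDerivAt_gfun y)
    have h2 : a * Real.exp a ≤ c * Real.exp c :=
      monotoneOn_mul_exp (Set.mem_Ici.2 ha) (Set.mem_Ici.2 (ha.trans hc.1.le)) hc.1.le
    rw [eq_div_iff (by linarith)] at hc'
    unfold tangentGap
    nlinarith

lemma concaveOn_tangentGap (a : ℝ) : ConcaveOn ℝ (Set.Iic (-1)) (tangentGap a) := by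
  have hd : ∀ x, HasDerivAt (tangentGap a) (x * Real.exp x - a * Real.exp a) x := by
    intro x
    have h := ((hasDerivAt_gfun x).sub_const (gfun a)).sub
      (((hasDerivAt_id x).sub_const a).const_mul (a * Real.exp a))
    refine h.congr_deriv ?_
    simp
  refine AntitoneOn.concaveOn_of_deriv (convex_Iic _)
    (fun x _ => (hd x).continuousAt.continuousWithinAt)
    (fun x _ => (hd x).differentiableAt.differentiableWithinAt) ?_
  intro x hx y hy hxy
  rw [interior_Iic, Set.mem_Iio] at hx hy
  rw [(hd x).deriv, (hd y).deriv]
  have : y * Real.exp y ≤ x * Real.exp x :=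
    strictAntiOn_mul_exp.antitoneOn (Set.mem_Iic.2 hx.le) (Set.mem_Iic.2 hy.le) hxy
  linarith

/-- If the tangent line at `a` meets the graph of `gfun` at `y < a`, then the tangent line at any
`b ≥ a` lies below the graph on `[y, ∞)`. -/
lemma tangentGap_nonneg {a b x y : ℝ} (hya : y < a) (h0 : tangentGap a y = 0) (hab : a ≤ b)
    (hyx : y ≤ x) : 0 ≤ tangentGap b x := by
  have ha : -1 < a := by
    by_contra h
    have := tangentGap_neg hya (not_lt.1 h)
    linarith
  rcases le_total (-1) x with hx | hx
  · exact tangentGap_nonneg_of_neg_one_le hx (by linarith)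
  · have h1 : 0 ≤ tangentGap b y := h0 ▸ tangentGap_le_tangentGap hya.le ha.le hab
    have h2 : 0 ≤ tangentGap b (-1) := tangentGap_nonneg_of_neg_one_le le_rfl (by linarith)
    have h3 := (concaveOn_tangentGap b).min_le_of_mem_Icc (Set.mem_Iic.2 (hyx.trans hx))
      (Set.mem_Iic.2 le_rfl) (Set.mem_Icc.2 ⟨hyx, hx⟩)
    exact (le_min h1 h2).trans h3

lemma hfun_ge_of_tangentGap {p u : ℝ} (hp : 0 < p) (hu : 0 < u)
    (h : 0 ≤ tangentGap (Real.log p) (Real.log u)) :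
    hfun p + p * Real.log p * (Real.log u - Real.log p) ≤ hfun u := by
  have h1 := hfun_exp (Real.log p)
  have h2 := hfun_exp (Real.log u)
  rw [Real.exp_log hp] at h1
  rw [Real.exp_log hu] at h2
  unfold tangentGap at h
  rw [Real.exp_log hp] at h
  nlinarith

lemma etaEq_iff_tangentGap {e η : ℝ} (hη : 0 < η) :
    etaEq e η ↔ tangentGap (Real.log η / e) (Real.log η / η) = 0 := by
  have h : ∀ y : ℝ, η ^ (1 / y) = Real.exp (Real.log η / y) := fun y => by
    rw [Real.rpow_def_of_pos hη]; congr 1; ring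
  unfold etaEq tangentGap
  rw [h, h, hfun_exp, hfun_exp, Real.log_exp, Real.log_exp]
  constructor <;> intro h <;> linarith

/-! ### Linearising `h` near zero -/

lemma mul_log_sub_le {x y : ℝ} (hx : 0 ≤ x) (hy : 0 < y) :
    x * (Real.log y - Real.log x) ≤ y - x := by
  rcases hx.eq_or_lt with rfl | hx
  · simpa using hy.le
  · rw [← Real.log_div hy.ne' hx.ne']
    have := mul_le_mul_of_nonneg_left (Real.log_le_sub_one_of_pos (div_pos hy hx)) hx.le
    rwa [mul_sub, mul_div_cancel₀ _ hx.ne', mul_one] at this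

lemma hfun_tangent_le {x y : ℝ} (hx : 0 ≤ x) (hy : 0 < y) :
    hfun y + Real.log y * (x - y) ≤ hfun x := by
  have := mul_log_sub_le hx hy
  unfold hfun
  nlinarith

lemma hfun_tangent_lt {x y : ℝ} (hx : 0 < x) (hy : 0 < y) (hxy : x ≠ y) :
    hfun y + Real.log y * (x - y) < hfun x := by
  have h : Real.log (y / x) < y / x - 1 :=
    Real.log_lt_sub_one_of_pos (div_pos hy hx)
      (by rw [Ne, div_eq_one_iff_eq hx.ne']; exact hxy.symm)
  have := mul_lt_mul_of_pos_left h hx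
  rw [mul_sub, mul_div_cancel₀ _ hx.ne', mul_one, Real.log_div hy.ne' hx.ne'] at this
  unfold hfun
  nlinarith

/-- The function `h` with its restriction to `[0, s]` replaced by the tangent line at `s`. -/
def hlin (s x : ℝ) : ℝ := hfun (max x s) + Real.log s * (min x s - s)

lemma continuous_hfun : Continuous hfun := by
  unfold hfun
  exact (Real.continuous_mul_log.sub continuous_id).add continuous_const

lemma continuous_hlin (s : ℝ) : Continuous (hlin s) := by
  unfold hlin
  exact (continuous_hfun.comp (by fun_prop)).add (by fun_prop)

lemma hlin_of_le {s x : ℝ} (h : x ≤ s) : hlin s x = hfun s + Real.log s * (x - s) := by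
  simp [hlin, h]

lemma hlin_of_ge {s x : ℝ} (h : s ≤ x) : hlin s x = hfun x := by
  simp [hlin, h]

lemma hlin_tangent_le {s x y : ℝ} (hs : 0 < s) :
    hlin s y + Real.log (max y s) * (x - y) ≤ hlin s x := by
  rcases le_total s y with hy | hy
  · rw [max_eq_left hy, hlin_of_ge hy]
    have hl := Real.log_le_log hs hy
    rcases le_total s x with hx | hx
    · rw [hlin_of_ge hx]
      exact hfun_tangent_le (hs.le.trans hx) (hs.trans_le hy)
    · rw [hlin_of_le hx]
      have := hfun_tangent_le hs.le (hs.trans_le hy)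
      nlinarith
  · rw [max_eq_right hy, hlin_of_le hy]
    rcases le_total s x with hx | hx
    · rw [hlin_of_ge hx]
      have := hfun_tangent_le (hs.le.trans hx) hs
      linarith
    · rw [hlin_of_le hx]; linarith

lemma hlin_le_hfun {s x : ℝ} (hs : 0 < s) (hx : 0 ≤ x) : hlin s x ≤ hfun x := by
  rcases le_total s x with h | h
  · rw [hlin_of_ge h]
  · rw [hlin_of_le h]; exact hfun_tangent_le hx hs

lemma hlin_add_le_hfun {r s x : ℝ} (hr : 0 < r) (hrs : r ≤ s) (hx : 0 ≤ x) (hxr : x ≤ r) :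
    hlin s x + (hfun r - hlin s r) ≤ hfun x := by
  rw [hlin_of_le hrs, hlin_of_le (hxr.trans hrs)]
  have h1 := hfun_tangent_le hx hr
  have h2 := Real.log_le_log hr hrs
  nlinarith

lemma hlin_mul_inv_le {s x q : ℝ} (hs : 0 < s) (hx : 0 < x) (hq : q ∈ Set.Icc (0 : ℝ) 1) :
    hlin s (q * (1 + x)⁻¹) ≤ hlin s q + x * (1 + x)⁻¹ * (Real.negMulLog q + x) := by
  have h1x : 0 < 1 + x := by linarith
  have hinv0 : 0 < (1 + x)⁻¹ := inv_pos.2 h1x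
  have hlog1x : Real.log (1 + x) ≤ x := by linarith [Real.log_le_sub_one_of_pos h1x]
  have ht := hlin_tangent_le (s := s) (x := q) (y := q * (1 + x)⁻¹) hs
  have hdiff : q - q * (1 + x)⁻¹ = x * (q * (1 + x)⁻¹) := by field_simp; ring
  rw [hdiff] at ht
  have h : q * -Real.log (max (q * (1 + x)⁻¹) s) ≤ Real.negMulLog q + x := by
    rcases hq.1.eq_or_lt with h0 | h0
    · simp only [← h0, zero_mul, Real.negMulLog_zero, zero_add]
      exact hx.le
    · have h1 : Real.log (q * (1 + x)⁻¹) ≤ Real.log (max (q * (1 + x)⁻¹) s) :=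
        Real.log_le_log (by positivity) (le_max_left _ _)
      rw [Real.log_mul h0.ne' hinv0.ne', Real.log_inv] at h1
      have h2 : q * -Real.log (max (q * (1 + x)⁻¹) s) ≤ q * (-Real.log q + x) :=
        mul_le_mul_of_nonneg_left (by linarith) h0.le
      have h3 : q * x ≤ x := mul_le_of_le_one_left hx.le hq.2
      simp only [Real.negMulLog]
      linarith
  have := mul_le_mul_of_nonneg_left h (by positivity : 0 ≤ x * (1 + x)⁻¹)
  linarith

lemma hlin_add_mul_inv_le {s x q c : ℝ} (hx : 0 < x) (hc : 0 ≤ c) (hq : 0 ≤ q)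
    (hqs : q ≤ s) (hqc : q + x * c ≤ s) :
    hlin s ((q + x * c) * (1 + x)⁻¹) ≤
      hlin s q + x * (1 + x)⁻¹ * (Real.negMulLog q + x + Real.log s * c) := by
  have h1x : 0 < 1 + x := by linarith
  have hinv0 : 0 < (1 + x)⁻¹ := inv_pos.2 h1x
  have hinv : (1 + x)⁻¹ ≤ 1 := inv_le_one_of_one_le₀ (by linarith)
  have hle : (q + x * c) * (1 + x)⁻¹ ≤ s :=
    (mul_le_of_le_one_right (by positivity) hinv).trans hqc
  rw [hlin_of_le hle, hlin_of_le hqs]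
  have hdiff : (q + x * c) * (1 + x)⁻¹ = q + x * (1 + x)⁻¹ * (c - q) := by field_simp; ring
  rw [hdiff]
  have h : Real.log s * (c - q) ≤ Real.negMulLog q + x + Real.log s * c := by
    rcases hq.eq_or_lt with h0 | h0
    · simp only [← h0, Real.negMulLog_zero]; linarith
    · have h1 := mul_le_mul_of_nonneg_left (Real.log_le_log h0 hqs) h0.le
      simp only [Real.negMulLog]
      linarith
  have := mul_le_mul_of_nonneg_left h (by positivity : 0 ≤ x * (1 + x)⁻¹)
  linarith

/-! ### Regular hypergraphs -/

section Hypergraph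

variable {E ι : Type*} [Fintype ι]

/-- The edge generating polynomial of the hypergraph with edges `A i`. -/
def edgePoly (A : ι → Finset E) (q : E → ℝ) : ℝ := ∑ i, ∏ e ∈ A i, q e

lemma continuous_edgePoly (A : ι → Finset E) : Continuous (edgePoly A) := by
  unfold edgePoly; fun_prop

lemma edgePoly_mul_const {A : ι → Finset E} {r : ℕ} (hr : ∀ i, (A i).card = r) (q : E → ℝ)
    (t : ℝ) : edgePoly A (fun e => q e * t) = edgePoly A q * t ^ r := by
  simp only [edgePoly, Finset.prod_mul_distrib, Finset.prod_const, hr, Finset.sum_mul]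

lemma edgePoly_update_add_le {A : ι → Finset E} {D : ℕ} (a : E)
    (hD : (Finset.univ.filter fun i => a ∈ A i).card = D) {q : E → ℝ}
    (hq : ∀ e, q e ∈ Set.Icc (0 : ℝ) 1) {t : ℝ} (ht : 0 ≤ t) :
    edgePoly A (Function.update q a (q a + t)) ≤ edgePoly A q + t * D := by
  have h : ∀ i, ∏ e ∈ A i, Function.update q a (q a + t) e ≤
      ∏ e ∈ A i, q e + if a ∈ A i then t else 0 := by
    intro i
    split_ifs with hi
    · rw [Finset.prod_update_of_mem hi, ← Finset.mul_prod_erase _ _ hi,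
        Finset.sdiff_singleton_eq_erase]
      have : ∏ e ∈ (A i).erase a, q e ≤ 1 :=
        Finset.prod_le_one (fun e _ => (hq e).1) fun e _ => (hq e).2
      nlinarith
    · rw [Finset.prod_update_of_notMem hi, add_zero]
  refine (Finset.sum_le_sum fun i _ => h i).trans ?_
  rw [Finset.sum_add_distrib, ← Finset.sum_filter, Finset.sum_const, hD, nsmul_eq_mul, mul_comm t]
  rfl

variable [Fintype E]

lemma sum_sum_mem {A : ι → Finset E} {D : ℕ}
    (hD : ∀ a, (Finset.univ.filter fun i => a ∈ A i).card = D) (f : E → ℝ) :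
    ∑ i, ∑ e ∈ A i, f e = D * ∑ e, f e := by
  rw [Finset.mul_sum]
  have : ∀ i, ∑ e ∈ A i, f e = ∑ e, if e ∈ A i then f e else 0 := fun i => by
    rw [← Finset.sum_filter, Finset.filter_mem_eq_inter, Finset.univ_inter]
  simp_rw [this]
  rw [Finset.sum_comm]
  refine Finset.sum_congr rfl fun e _ => ?_
  rw [← Finset.sum_filter, Finset.sum_const, hD, nsmul_eq_mul]

lemma degree_mul_card {A : ι → Finset E} {r D : ℕ} (hr : ∀ i, (A i).card = r)
    (hD : ∀ a, (Finset.univ.filter fun i => a ∈ A i).card = D) :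
    (D : ℝ) * Fintype.card E = r * Fintype.card ι := by
  have := sum_sum_mem hD (fun _ => 1)
  simp only [Finset.sum_const, hr, nsmul_eq_mul, mul_one, Finset.card_univ] at this
  rw [← this, mul_comm]

lemma sum_log_le {A : ι → Finset E} {r D : ℕ} (hr : ∀ i, (A i).card = r) (hr0 : 0 < r)
    (hD : ∀ a, (Finset.univ.filter fun i => a ∈ A i).card = D) (hι : 0 < Fintype.card ι)
    {η : ℝ} (hη : 0 < η) {q : E → ℝ} (hq : ∀ e, 0 < q e)
    (hP : edgePoly A q ≤ η * Fintype.card ι) :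
    ∑ e, Real.log (q e) ≤ Fintype.card E * (Real.log η / r) := by
  have h1 : ∀ i, ∑ e ∈ A i, Real.log (q e) ≤ (∏ e ∈ A i, q e) / η + (Real.log η - 1) := by
    intro i
    have hpos : 0 < ∏ e ∈ A i, q e := Finset.prod_pos fun e _ => hq e
    have := Real.log_le_sub_one_of_pos (div_pos hpos hη)
    rw [Real.log_div hpos.ne' hη.ne', Real.log_prod fun e _ => (hq e).ne'] at this
    linarith
  have h2 := Finset.sum_le_sum fun i (_ : i ∈ Finset.univ) => h1 i
  rw [sum_sum_mem hD, Finset.sum_add_distrib, ← Finset.sum_div, Finset.sum_const, nsmul_eq_mul,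
    Finset.card_univ] at h2
  have h3 : edgePoly A q / η ≤ Fintype.card ι := by
    rw [div_le_iff₀ hη]; linarith
  have h4 : (D : ℝ) * ∑ e, Real.log (q e) ≤ Fintype.card ι * Real.log η := by
    unfold edgePoly at h3
    linarith
  have hDE := degree_mul_card hr hD
  have hr' : (0 : ℝ) < r := by exact_mod_cast hr0
  have hι' : (0 : ℝ) < Fintype.card ι := by exact_mod_cast hι
  have hE0 : (0 : ℝ) ≤ Fintype.card E := by positivity
  rw [← mul_div_assoc, le_div_iff₀ hr']
  refine le_of_mul_le_mul_right ?_ hι'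
  calc (∑ e, Real.log (q e)) * r * Fintype.card ι
      = Fintype.card E * (D * ∑ e, Real.log (q e)) := by rw [mul_assoc, ← hDE]; ring
    _ ≤ Fintype.card E * (Fintype.card ι * Real.log η) := mul_le_mul_of_nonneg_left h4 hE0
    _ = _ := by ring

lemma sum_negMulLog_le {q : E → ℝ} (hq : ∀ e, 0 ≤ q e) {η : ℝ} (hη : 0 < η) (hη1 : η < 1)
    (hm : η * Fintype.card E ≤ ∑ e, q e) (hm1 : ∑ e, q e ≤ Fintype.card E) :
    ∑ e, Real.negMulLog (q e) ≤
      Fintype.card E * (max (1 / 2) (Real.sqrt η) * -Real.log η) := by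
  rcases (Fintype.card E).eq_zero_or_pos with hE | hE
  · have := Fintype.card_eq_zero_iff.1 hE
    simp
  have hE' : (0 : ℝ) < Fintype.card E := by exact_mod_cast hE
  obtain ⟨m, hmdef⟩ : ∃ m : ℝ, ∑ e, q e = m * Fintype.card E :=
    ⟨(∑ e, q e) / Fintype.card E, by field_simp⟩
  rw [hmdef] at hm hm1
  have hm : η ≤ m := le_of_mul_le_mul_right hm hE'
  have hm1 : m ≤ 1 := by nlinarith
  have hm0 : 0 < m := hη.trans_le hm
  have h1 : ∀ e, Real.negMulLog (q e) ≤ -Real.log m * q e + (m - q e) := fun e => by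
    have := mul_log_sub_le (hq e) hm0
    simp only [Real.negMulLog]
    linarith
  have h2 := Finset.sum_le_sum fun e (_ : e ∈ Finset.univ) => h1 e
  rw [Finset.sum_add_distrib, ← Finset.mul_sum, Finset.sum_sub_distrib, hmdef, Finset.sum_const,
    nsmul_eq_mul, Finset.card_univ] at h2
  have hlogη : 0 < -Real.log η := by linarith [Real.log_neg hη hη1]
  have hlm : -Real.log m ≤ -Real.log η := by linarith [Real.log_le_log hη hm]
  have hlm0 : 0 ≤ -Real.log m := by linarith [Real.log_nonpos hm0.le hm1]
  have h3 : -Real.log m * m ≤ max (1 / 2) (Real.sqrt η) * -Real.log η := by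
    rcases le_total m (Real.sqrt η) with h | h
    · have : m ≤ max (1 / 2) (Real.sqrt η) := h.trans (le_max_right _ _)
      nlinarith
    · have h4 := Real.log_le_log (Real.sqrt_pos.2 hη) h
      rw [Real.log_sqrt hη.le] at h4
      have : 1 / 2 ≤ max (1 / 2) (Real.sqrt η) := le_max_left _ _
      nlinarith
  nlinarith

/-- Raising a small coordinate of `q` while scaling down all of `q` keeps the edge polynomial below
its bound and strictly decreases the linearised entropy. -/
lemma exists_hlin_sum_lt {A : ι → Finset E} {r D : ℕ} (hr : ∀ i, (A i).card = r)
    (hD : ∀ a, (Finset.univ.filter fun i => a ∈ A i).card = D)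
    {η κ s : ℝ} (hη : 0 < η) (hη1 : η < 1) (hκ : max (1 / 2) (Real.sqrt η) < κ) (hs : 0 < s)
    (hs1 : s < 1) (hlogs : η * Real.log s = κ * Real.log η)
    {q : E → ℝ} (hq : ∀ e, q e ∈ Set.Icc (0 : ℝ) 1)
    (hP : edgePoly A q ≤ η * Fintype.card ι) (hm : η * Fintype.card E ≤ ∑ e, q e)
    {a : E} (ha : q a < s) :
    ∃ q' : E → ℝ, (∀ e, q' e ∈ Set.Icc (0 : ℝ) 1) ∧ edgePoly A q' ≤ η * Fintype.card ι ∧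
      ∑ e, hlin s (q' e) < ∑ e, hlin s (q e) := by
  have hE : 0 < Fintype.card E := Fintype.card_pos_iff.2 ⟨a⟩
  have hE' : (0 : ℝ) < Fintype.card E := by exact_mod_cast hE
  set M : ℝ := (Fintype.card E : ℝ) with hM
  have hgap : 0 < (κ - max (1 / 2) (Real.sqrt η)) * -Real.log η :=
    mul_pos (by linarith) (by linarith [Real.log_neg hη hη1])
  have hpos1 : 0 < (s - q a) / (η * M) := div_pos (by linarith) (by positivity)
  obtain ⟨x, hx0, hx⟩ := exists_between (lt_min hgap hpos1)
  have hxgap := hx.trans_le (min_le_left _ _)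
  have hxs := hx.trans_le (min_le_right _ _)
  rw [lt_div_iff₀ (by positivity)] at hxs
  have h1x : 0 < 1 + x := by linarith
  set τ : ℝ := x * (η * M) with hτ
  have hτ0 : 0 < τ := by positivity
  set u : E → ℝ := Function.update q a (q a + τ) with hu
  have hinv : (1 + x)⁻¹ ≤ 1 := inv_le_one_of_one_le₀ (by linarith)
  have hinv0 : 0 < (1 + x)⁻¹ := inv_pos.2 h1x
  have hu01 : ∀ e, u e ∈ Set.Icc (0 : ℝ) 1 := by
    intro e
    by_cases he : e = a
    · subst he
      simp only [hu, Function.update_self, Set.mem_Icc]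
      exact ⟨by linarith [(hq e).1], by linarith⟩
    · simp only [hu, Function.update_of_ne he]; exact hq e
  refine ⟨fun e => u e * (1 + x)⁻¹, fun e => ?_, ?_, ?_⟩
  · exact ⟨mul_nonneg (hu01 e).1 hinv0.le, mul_le_one₀ (hu01 e).2 hinv0.le hinv⟩
  · rw [edgePoly_mul_const hr, inv_pow, mul_inv_le_iff₀ (by positivity)]
    have h1 := edgePoly_update_add_le a (hD a) hq hτ0.le
    have h2 := degree_mul_card hr hD
    have h3 : 1 + (r : ℝ) * x ≤ (1 + x) ^ r := one_add_mul_le_pow (by linarith) r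
    have h4 : τ * D = η * Fintype.card ι * (r * x) := by
      rw [hτ]
      calc x * (η * M) * D = x * η * (D * M) := by ring
        _ = _ := by rw [hM, h2]; ring
    have h5 : 0 ≤ η * (Fintype.card ι : ℝ) := by positivity
    nlinarith
  · have key : ∀ e, hlin s (u e * (1 + x)⁻¹) ≤ hlin s (q e) +
        x * (1 + x)⁻¹ * (Real.negMulLog (q e) + x + if e = a then κ * Real.log η * M else 0) := by
      intro e
      by_cases he : e = a
      · subst he
        have hue : u e = q e + x * (η * M) := by simp [hu, hτ]
        have := hlin_add_mul_inv_le hx0 (by positivity : 0 ≤ η * M) (hq e).1 ha.le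
          (by linarith)
        rw [if_pos rfl, hue, ← hlogs]
        linarith
      · have hue : u e = q e := by simp [hu, he]
        rw [hue, if_neg he, add_zero]
        exact hlin_mul_inv_le hs hx0 (hq e)
    have hsum := Finset.sum_le_sum fun e (_ : e ∈ Finset.univ) => key e
    rw [Finset.sum_add_distrib, ← Finset.mul_sum, Finset.sum_add_distrib, Finset.sum_add_distrib,
      Finset.sum_ite_eq' Finset.univ a, if_pos (Finset.mem_univ a), Finset.sum_const, nsmul_eq_mul,
      Finset.card_univ, ← hM] at hsum
    have hm1 : ∑ e, q e ≤ M := by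
      have := Finset.sum_le_sum fun e (_ : e ∈ Finset.univ) => (hq e).2
      simpa [hM] using this
    have hneg := sum_negMulLog_le (fun e => (hq e).1) hη hη1 hm hm1
    rw [← hM] at hneg
    have h12 : ∑ e, Real.negMulLog (q e) + M * x + κ * Real.log η * M < 0 := by nlinarith
    have h13 : 0 < x * (1 + x)⁻¹ := by positivity
    nlinarith [mul_neg_of_pos_of_neg h13 h12]

/-- The linearised entropy of a point with small edge polynomial is at least that of the constant
point. -/
lemma card_mul_hfun_le_sum_hlin {A : ι → Finset E} {r D : ℕ} (hr : ∀ i, (A i).card = r)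
    (hr0 : 0 < r) (hD : ∀ a, (Finset.univ.filter fun i => a ∈ A i).card = D)
    (hι : 0 < Fintype.card ι)
    {η κ s p : ℝ} (hη : 0 < η) (hη1 : η < 1) (hκ : max (1 / 2) (Real.sqrt η) < κ) (hs : 0 < s)
    (hs1 : s < 1) (hlogs : η * Real.log s = κ * Real.log η) (hp1 : p < 1) (hηp : η ≤ p)
    (hsp : s ≤ p) (hlogp : Real.log p = Real.log η / r)
    (htan : ∀ u, s ≤ u → hfun p + p * Real.log p * (Real.log u - Real.log p) ≤ hfun u)
    {q : E → ℝ} (hq : ∀ e, q e ∈ Set.Icc (0 : ℝ) 1)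
    (hP : edgePoly A q ≤ η * Fintype.card ι) :
    Fintype.card E * hfun p ≤ ∑ e, hlin s (q e) := by
  have hcomp : IsCompact
      ((Set.univ.pi fun _ : E => Set.Icc (0 : ℝ) 1) ∩
        {q | edgePoly A q ≤ η * Fintype.card ι}) :=
    (isCompact_univ_pi fun _ => isCompact_Icc).inter_right
      (isClosed_le (continuous_edgePoly A) continuous_const)
  obtain ⟨w, ⟨hw, hwP⟩, hmin⟩ := hcomp.exists_isMinOn ⟨q, fun e _ => hq e, hP⟩
    (f := fun q => ∑ e, hlin s (q e))
    (continuous_finsetSum _ fun e _ => (continuous_hlin s).comp (continuous_apply e)).continuousOn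
  refine le_trans ?_ (hmin ⟨fun e _ => hq e, hP⟩ : ∑ e, hlin s (w e) ≤ ∑ e, hlin s (q e))
  have hw : ∀ e, w e ∈ Set.Icc (0 : ℝ) 1 := fun e => hw e (Set.mem_univ e)
  have hp0 : 0 < p := hη.trans_le hηp
  have hlp : Real.log p < 0 := Real.log_neg hp0 hp1
  rcases lt_or_ge (∑ e, w e) (η * Fintype.card E) with hm | hm
  · have h1 : ∀ e, hfun p + Real.log p * (w e - p) ≤ hlin s (w e) := fun e => by
      have := hlin_tangent_le (x := w e) (y := p) hs
      rwa [max_eq_left hsp, hlin_of_ge hsp] at this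
    have h2 := Finset.sum_le_sum fun e (_ : e ∈ Finset.univ) => h1 e
    rw [Finset.sum_add_distrib, ← Finset.mul_sum, Finset.sum_sub_distrib, Finset.sum_const,
      Finset.sum_const, nsmul_eq_mul, nsmul_eq_mul, Finset.card_univ] at h2
    have h3 : η * (Fintype.card E : ℝ) ≤ p * Fintype.card E :=
      mul_le_mul_of_nonneg_right hηp (by positivity)
    nlinarith
  · have hws : ∀ e, s ≤ w e := by
      intro a
      by_contra ha
      obtain ⟨q', hq', hP', hlt⟩ := exists_hlin_sum_lt hr hD hη hη1 hκ hs hs1 hlogs hw hwP hm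
        (not_le.1 ha)
      exact absurd (hmin ⟨fun e _ => hq' e, hP'⟩ :
        ∑ e, hlin s (w e) ≤ ∑ e, hlin s (q' e)) (not_le.2 hlt)
    have h1 : ∀ e, hfun p + p * Real.log p * (Real.log (w e) - Real.log p) ≤ hlin s (w e) :=
      fun e => by rw [hlin_of_ge (hws e)]; exact htan _ (hws e)
    have h2 := Finset.sum_le_sum fun e (_ : e ∈ Finset.univ) => h1 e
    rw [Finset.sum_add_distrib, ← Finset.mul_sum, Finset.sum_sub_distrib, Finset.sum_const,
      Finset.sum_const, nsmul_eq_mul, nsmul_eq_mul, Finset.card_univ] at h2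
    have h3 := sum_log_le hr hr0 hD hι hη (fun e => hs.trans_le (hws e)) hwP
    rw [← hlogp] at h3
    have h4 : 0 ≤ p * -Real.log p := mul_nonneg hp0.le (by linarith)
    nlinarith

lemma card_mul_hfun_add_le_sum_hfun {A : ι → Finset E} {r D : ℕ} (hr : ∀ i, (A i).card = r)
    (hr0 : 0 < r) (hD : ∀ a, (Finset.univ.filter fun i => a ∈ A i).card = D)
    (hι : 0 < Fintype.card ι)
    {η κ s p t : ℝ} (hη : 0 < η) (hη1 : η < 1) (hκ : max (1 / 2) (Real.sqrt η) < κ) (hs : 0 < s)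
    (hs1 : s < 1) (hlogs : η * Real.log s = κ * Real.log η) (hp1 : p < 1) (hηp : η ≤ p)
    (hsp : s ≤ p) (hlogp : Real.log p = Real.log η / r)
    (htan : ∀ u, s ≤ u → hfun p + p * Real.log p * (Real.log u - Real.log p) ≤ hfun u)
    (ht : 0 < t) (hts : t ≤ s)
    {q : E → ℝ} (hq : ∀ e, q e ∈ Set.Icc (0 : ℝ) 1)
    (hP : edgePoly A q ≤ η * Fintype.card ι) :
    Fintype.card E * hfun p +
      (Finset.univ.filter fun e => q e < t).card * (hfun t - hlin s t) ≤ ∑ e, hfun (q e) := by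
  have h1 := card_mul_hfun_le_sum_hlin hr hr0 hD hι hη hη1 hκ hs hs1 hlogs hp1 hηp hsp hlogp htan
    hq hP
  have h2 : ∀ e, hlin s (q e) + (if q e < t then hfun t - hlin s t else 0) ≤ hfun (q e) := by
    intro e
    split_ifs with h
    · exact hlin_add_le_hfun ht hts (hq e).1 h.le
    · rw [add_zero]; exact hlin_le_hfun hs (hq e).1
  have h3 := Finset.sum_le_sum fun e (_ : e ∈ Finset.univ) => h2 e
  rw [Finset.sum_add_distrib, ← Finset.sum_filter, Finset.sum_const, nsmul_eq_mul] at h3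
  linarith

end Hypergraph

/-! ### Copies of `H` in the complete graph -/

section Copies

variable {k n : ℕ}

/-- The copies of `H` in `K_n`. -/
abbrev CopyIn (H : SimpleGraph (Fin k)) (n : ℕ) :=
  {K : (⊤ : SimpleGraph (Fin n)).Subgraph // Nonempty (H ≃g K.coe)}

instance (H : SimpleGraph (Fin k)) (n : ℕ) : Fintype (CopyIn H n) := Fintype.ofFinite _

/-- The edges of a copy of `H` in `K_n`. -/
def copyEdges {H : SimpleGraph (Fin k)} (K : CopyIn H n) : Finset (Edge n) :=
  Finset.univ.filter fun e => (e : Sym2 (Fin n)) ∈ K.1.edgeSet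

lemma mem_copyEdges {H : SimpleGraph (Fin k)} {K : CopyIn H n} {e : Edge n} :
    e ∈ copyEdges K ↔ (e : Sym2 (Fin n)) ∈ K.1.edgeSet := by simp [copyEdges]

lemma not_isDiag_of_mem_edgeSet {G : SimpleGraph (Fin n)} {K : G.Subgraph} {e : Sym2 (Fin n)}
    (h : e ∈ K.edgeSet) : ¬ e.IsDiag :=
  G.not_isDiag_of_mem_edgeSet (K.edgeSet_subset h)

lemma card_copyEdges {H : SimpleGraph (Fin k)} (K : CopyIn H n) :
    (copyEdges K).card = H.edgeSet.ncard := by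
  obtain ⟨φ⟩ := K.2
  have h1 : (copyEdges K).card = K.1.edgeSet.ncard := by
    rw [← Set.ncard_coe_finset, ← Set.ncard_image_of_injective _ Subtype.val_injective]
    congr 1
    ext e
    simp only [Set.mem_image, Finset.mem_coe, mem_copyEdges]
    exact ⟨fun ⟨a, ha, hae⟩ => hae ▸ ha, fun h => ⟨⟨e, not_isDiag_of_mem_edgeSet h⟩, h, rfl⟩⟩
  rw [h1, ← SimpleGraph.Subgraph.image_coe_edgeSet_coe,
    Set.ncard_image_of_injective _ (Sym2.map.injective Subtype.val_injective),
    ← Nat.card_coe_set_eq, ← Nat.card_coe_set_eq]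
  exact (Nat.card_congr φ.mapEdgeSet).symm

lemma exists_perm_map_eq (a b : Edge n) :
    ∃ σ : Equiv.Perm (Fin n), Sym2.map σ (a : Sym2 (Fin n)) = b := by
  obtain ⟨a, ha⟩ := a
  obtain ⟨b, hb⟩ := b
  induction a with | _ u v
  induction b with | _ u' v'
  rw [Sym2.mk_isDiag_iff] at ha hb
  refine ⟨(Equiv.swap u u').trans (Equiv.swap (Equiv.swap u u' v) v'), ?_⟩
  have h1 : u' ≠ Equiv.swap u u' v := by
    intro h
    apply ha
    apply (Equiv.swap u u').injective
    rw [← h, Equiv.swap_apply_left]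
  simp [Equiv.swap_apply_of_ne_of_ne h1 hb]

lemma card_filter_mem_copyEdges_le (H : SimpleGraph (Fin k)) (a b : Edge n) :
    (Finset.univ.filter fun K : CopyIn H n => a ∈ copyEdges K).card ≤
      (Finset.univ.filter fun K : CopyIn H n => b ∈ copyEdges K).card := by
  obtain ⟨σ, hσ⟩ := exists_perm_map_eq a b
  let φ : (⊤ : SimpleGraph (Fin n)) ≃g (⊤ : SimpleGraph (Fin n)) :=
    SimpleGraph.Iso.completeGraph σ
  let F : CopyIn H n → CopyIn H n := fun K =>
    ⟨K.1.map φ.toHom, K.2.map fun ψ => ψ.trans (φ.toCopy.isoSubgraphMap K.1)⟩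
  refine Finset.card_le_card_of_injOn F ?_ ?_
  · intro K hK
    simp only [Finset.coe_filter, Finset.mem_univ, true_and, Set.mem_ofPred_eq,
      mem_copyEdges] at hK ⊢
    rw [SimpleGraph.Subgraph.edgeSet_map]
    exact ⟨a, hK, hσ⟩
  · intro K _ L _ h
    have h' : K.1.map φ.toHom = L.1.map φ.toHom := congrArg Subtype.val h
    have h2 := congrArg (SimpleGraph.Subgraph.map φ.symm.toHom) h'
    rw [← SimpleGraph.Subgraph.map_comp, ← SimpleGraph.Subgraph.map_comp] at h2
    have h3 : φ.symm.toHom.comp φ.toHom = SimpleGraph.Hom.id := by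
      ext x; simp
    rw [h3, SimpleGraph.Subgraph.map_id, SimpleGraph.Subgraph.map_id] at h2
    exact Subtype.ext h2

lemma exists_degree (H : SimpleGraph (Fin k)) (n : ℕ) : ∃ D : ℕ, ∀ a : Edge n,
    (Finset.univ.filter fun K : CopyIn H n => a ∈ copyEdges K).card = D := by
  rcases isEmpty_or_nonempty (Edge n) with h | ⟨⟨b⟩⟩
  · exact ⟨0, fun a => h.elim a⟩
  · exact ⟨_, fun a => (card_filter_mem_copyEdges_le H a b).antisymm
      (card_filter_mem_copyEdges_le H b a)⟩

/-- A subgraph of `G`, viewed as a subgraph of the complete graph. -/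
def liftTop {G : SimpleGraph (Fin n)} (K : G.Subgraph) : (⊤ : SimpleGraph (Fin n)).Subgraph where
  verts := K.verts
  Adj := K.Adj
  adj_sub h := (K.adj_sub h).ne
  edge_vert := K.edge_vert
  symm := K.symm

lemma liftTop_injective (G : SimpleGraph (Fin n)) :
    Function.Injective (liftTop : G.Subgraph → _) := fun _ _ h =>
  SimpleGraph.Subgraph.ext (congrArg (fun S => S.verts) h :)
    (congrArg (fun S => S.Adj) h :)

lemma countCopies_eq_card (H : SimpleGraph (Fin k)) (G : SimpleGraph (Fin n)) :
    countCopies H G = (Finset.univ.filter fun K : CopyIn H n => K.1.edgeSet ⊆ G.edgeSet).card := by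
  rw [countCopies, ← Set.ncard_image_of_injective _ (liftTop_injective G),
    ← Set.ncard_coe_finset, ← Set.ncard_image_of_injective _ Subtype.val_injective]
  congr 1
  ext K
  simp only [Set.mem_image, Set.mem_ofPred_eq, Finset.coe_filter, Finset.mem_univ, true_and]
  constructor
  · rintro ⟨L, hL, rfl⟩
    exact ⟨⟨liftTop L, hL⟩, L.edgeSet_subset, rfl⟩
  · rintro ⟨⟨K, hK⟩, hKG, rfl⟩
    exact ⟨⟨K.verts, K.Adj, fun {v w} h => hKG (a := s(v, w)) h, K.edge_vert, K.symm⟩, hK, rfl⟩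

lemma NHKn_eq_card (H : SimpleGraph (Fin k)) (n : ℕ) :
    NHKn H n = Fintype.card (CopyIn H n) := by
  rw [NHKn, countCopies_eq_card, Finset.filter_true_of_mem fun K _ => K.1.edgeSet_subset,
    Finset.card_univ]

lemma edgeSet_subset_toSG_iff {H : SimpleGraph (Fin k)} (K : CopyIn H n) (G : EGraph n) :
    K.1.edgeSet ⊆ (toSG G).edgeSet ↔ ∀ e ∈ copyEdges K, G e = true := by
  simp only [toSG, SimpleGraph.edgeSet_fromEdgeSet, mem_copyEdges]
  constructor
  · intro h e he
    obtain ⟨_, h2⟩ := (h he).1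
    exact h2
  · intro h e he
    have hd := not_isDiag_of_mem_edgeSet he
    exact ⟨⟨hd, h ⟨e, hd⟩ he⟩, hd⟩

lemma sum_wt_mul_indicator (q : Edge n → ℝ) (A : Finset (Edge n)) :
    ∑ G : EGraph n, wt q G * (if ∀ e ∈ A, G e = true then 1 else 0) = ∏ e ∈ A, q e := by
  have h1 : ∀ G : EGraph n, wt q G * (if ∀ e ∈ A, G e = true then 1 else 0) =
      ∏ e, (if G e then q e else if e ∈ A then 0 else 1 - q e) := by
    intro G
    split_ifs with h
    · rw [mul_one, wt]
      refine Finset.prod_congr rfl fun e _ => ?_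
      by_cases he : e ∈ A
      · simp [h e he]
      · simp [he]
    · push Not at h
      obtain ⟨e, he, hGe⟩ := h
      rw [mul_zero, Finset.prod_eq_zero (Finset.mem_univ e)]
      simp [he, hGe]
  simp_rw [h1]
  have h2 := Finset.prod_univ_sum (fun _ : Edge n => (Finset.univ : Finset Bool))
    (fun e b => if b = true then q e else if e ∈ A then 0 else 1 - q e)
  rw [Fintype.piFinset_univ] at h2
  rw [← h2, ← Finset.prod_subset (Finset.subset_univ A)]
  · exact Finset.prod_congr rfl fun e he => by simp [he]
  · intro e _ he
    simp [he]

lemma expNH_eq_edgePoly (H : SimpleGraph (Fin k)) (q : Edge n → ℝ) :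
    expNH H q = edgePoly (copyEdges : CopyIn H n → _) q := by
  unfold expNH edgePoly
  simp_rw [← sum_wt_mul_indicator]
  rw [Finset.sum_comm]
  refine Finset.sum_congr rfl fun G _ => ?_
  rw [← Finset.mul_sum, NH, countCopies_eq_card, Finset.sum_boole]
  simp_rw [edgeSet_subset_toSG_iff]

lemma card_copyIn_pos (H : SimpleGraph (Fin k)) (hkn : k ≤ n) :
    0 < Fintype.card (CopyIn H n) := by
  have h : H.IsContained (⊤ : SimpleGraph (Fin n)) :=
    SimpleGraph.isContained_top_iff.2 ⟨Fin.castLEEmb hkn⟩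
  obtain ⟨K, hK⟩ := SimpleGraph.isContained_iff_exists_iso_subgraph.1 h
  exact Fintype.card_pos_iff.2 ⟨⟨K, hK⟩⟩

lemma card_edge (n : ℕ) : Fintype.card (Edge n) = n.choose 2 := by
  rw [Sym2.card_subtype_not_diag, Fintype.card_fin]

end Copies

lemma exists_card_mul_hfun_add_le_sum_hfun {r : ℕ} (hr0 : 0 < r) {ηstar η : ℝ}
    (hηstar : ηstar ∈ Set.Ioo (0 : ℝ) 1) (hEq : etaEq r ηstar) (hη : η ∈ Set.Ioo ηstar 1) :
    ∃ c : ℝ, 0 < c ∧ ∀ {E ι : Type} [Fintype E] [Fintype ι] (A : ι → Finset E) (D : ℕ),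
      (∀ i, (A i).card = r) → (∀ a, (Finset.univ.filter fun i => a ∈ A i).card = D) →
      0 < Fintype.card ι → ∀ q : E → ℝ, (∀ e, q e ∈ Set.Icc (0 : ℝ) 1) →
      edgePoly A q ≤ η * Fintype.card ι →
      Fintype.card E * hfun (η ^ (1 / (r : ℝ))) +
        (Finset.univ.filter fun e => q e < η ^ (1 / η)).card * c ≤ ∑ e, hfun (q e) := by
  obtain ⟨hηs0, hηs1⟩ := hηstar
  obtain ⟨hηη, hη1⟩ := hη
  have hη0 : 0 < η := hηs0.trans hηη
  have hr1 : (1 : ℝ) ≤ r := by exact_mod_cast hr0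
  rw [etaEq_iff_tangentGap hηs0] at hEq
  have hl : Real.log η < 0 := Real.log_neg hη0 hη1
  have hls : Real.log ηstar < 0 := Real.log_neg hηs0 hηs1
  have hll : Real.log ηstar < Real.log η := Real.log_lt_log hηs0 hηη
  have hexp : ∀ y : ℝ, η ^ (1 / y) = Real.exp (Real.log η / y) := fun y => by
    rw [Real.rpow_def_of_pos hη0]; congr 1; ring
  rw [hexp, hexp]
  have hsq1 : Real.sqrt η < 1 := by rw [Real.sqrt_lt' one_pos]; linarith
  have hsqη : η ≤ Real.sqrt η := Real.le_sqrt_of_sq_le (by nlinarith)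
  obtain ⟨κ, hκ, hκ1⟩ := exists_between (max_lt (by norm_num : (1 / 2 : ℝ) < 1) hsq1)
  have hκη : η < κ := hsqη.trans_lt ((le_max_right _ _).trans_lt hκ)
  obtain ⟨L, hL⟩ : ∃ L, Real.log η = L := ⟨_, rfl⟩
  rw [hL] at hl hll ⊢
  have hxs : L / η < κ * L / η := by
    apply div_lt_div_of_pos_right _ hη0; nlinarith
  have hLr : L ≤ L / r := by rw [le_div_iff₀ (by linarith)]; nlinarith
  have hsL : κ * L / η ≤ L := by rw [div_le_iff₀ hη0]; nlinarith
  have hηL : η = Real.exp L := by rw [← hL, Real.exp_log hη0]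
  have hts := Real.exp_lt_exp.2 hxs
  have htan : ∀ u, Real.exp (κ * L / η) ≤ u →
      hfun (Real.exp (L / r)) + Real.exp (L / r) * Real.log (Real.exp (L / r)) *
        (Real.log u - Real.log (Real.exp (L / r))) ≤ hfun u := by
    intro u hu
    have hu0 : 0 < u := (Real.exp_pos _).trans_le hu
    refine hfun_ge_of_tangentGap (Real.exp_pos _) hu0 ?_
    rw [Real.log_exp]
    refine tangentGap_nonneg ?_ hEq ?_ (y := Real.log ηstar / ηstar) ?_
    · rw [div_lt_div_iff₀ hηs0 (by linarith)]; nlinarith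
    · exact div_le_div_of_nonneg_right hll.le (by linarith)
    · have h1 : Real.log ηstar / ηstar ≤ L / η := by
        rw [div_le_div_iff₀ hηs0 hη0]; nlinarith
      have h2 := (Real.le_log_iff_exp_le hu0).2 hu
      linarith
  refine ⟨hfun (Real.exp (L / η)) - hlin (Real.exp (κ * L / η)) (Real.exp (L / η)), ?_, ?_⟩
  · have := hfun_tangent_lt (Real.exp_pos (L / η)) (Real.exp_pos (κ * L / η)) hts.ne
    rw [hlin_of_le hts.le]
    linarith
  · intro E ι _ _ A D hr hD hι q hq hP
    exact card_mul_hfun_add_le_sum_hfun hr hr0 hD hι hη0 hη1 hκ (Real.exp_pos _)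
      (Real.exp_lt_one_iff.2 (by linarith)) (by rw [Real.log_exp, hL]; field_simp)
      (Real.exp_lt_one_iff.2 (div_neg_of_neg_of_pos hl (by linarith)))
      (hηL.le.trans (Real.exp_le_exp.2 hLr))
      (Real.exp_le_exp.2 (hsL.trans hLr)) (by rw [Real.log_exp, hL]) htan
      (Real.exp_pos _) hts.le hq hP

/-- stability version of Zhao's Lemma 5.2: near minimizers have few
very small entries. -/
theorem statement7 {k : ℕ} (H : SimpleGraph (Fin k)) (hH : H.edgeSet.Nonempty)
    (ηstar η : ℝ) (hηstar : ηstar ∈ Set.Ioo (0:ℝ) 1) (hEq : etaEq (eH H) ηstar)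
    (hη : η ∈ Set.Ioo ηstar 1) :
    ∃ ε0 : ℝ, 0 < ε0 ∧ ∀ ε : ℝ, ε ∈ Set.Ioo (0:ℝ) ε0 → ∀ n : ℕ, k ≤ n →
      ∀ q : Edge n → ℝ, (∀ e, q e ∈ Set.Icc (0:ℝ) 1) →
        (∑ e : Edge n, hfun (q e)) ≤
          (n.choose 2 : ℝ) * hfun (η ^ (1 / eH H)) + ε ^ 2 * (n.choose 2 : ℝ) →
        expNH H q < η * NHKn H n →
        ((Finset.univ.filter (fun e : Edge n => q e < η ^ (1 / η))).card : ℝ) ≤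
          ε * (n.choose 2 : ℝ) := by
  have hr0 : 0 < H.edgeSet.ncard := (Set.ncard_pos (Set.toFinite _)).2 hH
  obtain ⟨c, hc, hbound⟩ := exists_card_mul_hfun_add_le_sum_hfun hr0 hηstar hEq hη
  refine ⟨c, hc, fun ε hε n hkn q hq hsum hP => ?_⟩
  obtain ⟨D, hD⟩ := exists_degree H n
  rw [expNH_eq_edgePoly, NHKn_eq_card] at hP
  have key := hbound copyEdges D card_copyEdges (fun a => by convert hD a)
    (card_copyIn_pos H hkn) q hq hP.le
  rw [card_edge] at key
  have hM : (0 : ℝ) ≤ n.choose 2 := by positivity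
  refine le_of_mul_le_mul_right ?_ hc
  calc _ ≤ ε * (ε * (n.choose 2 : ℝ)) := by unfold eH at hsum; linarith
    _ ≤ ε * (c * (n.choose 2 : ℝ)) :=
      mul_le_mul_of_nonneg_left (mul_le_mul_of_nonneg_right hε.2.le hM) hε.1.le
    _ = _ := by ring

end LowerTails
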